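/- arXiv:1409.5514 — 2 statements merged into one kernel-verified Lean document; each statement's English description precedes it below -/
import Mathlib

section
/- Characterization of the solvability set: The solvability set satisfies D = {P ∈ ℝ^N : H̄_∞(P) < σ̲}. Moreover, for every P ∈ D, if (u, c) is a solution of the cell problem H(x, Du + P) = a on T^N, then c = H̄_∞(P). -/
open Set Filter MeasureTheory

noncomputable section

abbrev Euc (N : ℕ) := EuclideanSpace ℝ (Fin N)

def intVec {N : ℕ} (z : Fin N → ℤ) : Euc N :=
  (EuclideanSpace.equiv (Fin N) ℝ).symm (fun i => (z i : ℝ))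

def IsZPeriodic {N : ℕ} (u : Euc N → ℝ) : Prop :=
  ∀ (x : Euc N) (z : Fin N → ℤ), u (x + intVec z) = u x

def IsZPeriodicH {N : ℕ} (H : Euc N → Euc N → ℝ) : Prop :=
  ∀ (x p : Euc N) (z : Fin N → ℤ), H (x + intVec z) p = H x p

def superDiff {N : ℕ} (u : Euc N → ℝ) (x : Euc N) : Set (Euc N) :=
  { q | ∃ φ : Euc N → ℝ, ContDiff ℝ 1 φ ∧ IsZPeriodic φ ∧
        (∀ y, u y - φ y ≤ u x - φ x) ∧ q = gradient φ x }

def subDiff {N : ℕ} (u : Euc N → ℝ) (x : Euc N) : Set (Euc N) :=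
  { q | ∃ φ : Euc N → ℝ, ContDiff ℝ 1 φ ∧ IsZPeriodic φ ∧
        (∀ y, u x - φ x ≤ u y - φ y) ∧ q = gradient φ x }

def IsCellSubsolution {N : ℕ} (H : Euc N → Euc N → ℝ) (P : Euc N) (a : ℝ) (u : Euc N → ℝ) : Prop :=
  ∀ x, ∀ q ∈ superDiff u x, H x (q + P) ≤ a

def IsCellSupersolution {N : ℕ} (H : Euc N → Euc N → ℝ) (P : Euc N) (a : ℝ) (u : Euc N → ℝ) : Prop :=
  ∀ x, ∀ q ∈ subDiff u x, a ≤ H x (q + P)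

def IsCellSolution {N : ℕ} (H : Euc N → Euc N → ℝ) (P : Euc N) (u : Euc N → ℝ) (a : ℝ) : Prop :=
  (∃ K : NNReal, LipschitzWith K u) ∧ IsZPeriodic u ∧
    IsCellSubsolution H P a u ∧ IsCellSupersolution H P a u

def IsCoerciveH {N : ℕ} (H : Euc N → Euc N → ℝ) : Prop :=
  ∀ C : ℝ, ∃ r : ℝ, ∀ x p : Euc N, r ≤ ‖p‖ → C ≤ H x p

/-- The periodic penalty `∑ᵢ (1 - cos (2π zᵢ))`, a smooth substitute for `|z|²` on the torus. -/
def torusPenalty {N : ℕ} (z : Euc N) : ℝ := ∑ i, (1 - Real.cos (2 * Real.pi * z i))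

/-- The gradient of `torusPenalty`. -/
def torusPenaltyGrad {N : ℕ} (z : Euc N) : Euc N :=
  WithLp.toLp 2 (fun i => 2 * Real.pi * Real.sin (2 * Real.pi * z i))

lemma intVec_apply {N : ℕ} (z : Fin N → ℤ) (i : Fin N) : intVec z i = z i := rfl

lemma intVec_neg {N : ℕ} (z : Fin N → ℤ) : intVec (-z) = -intVec z := by
  ext i; simp [intVec_apply]

lemma IsZPeriodic.sub_intVec {N : ℕ} {u : Euc N → ℝ} (hu : IsZPeriodic u) (x : Euc N)
    (z : Fin N → ℤ) : u (x - intVec z) = u x := by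
  rw [sub_eq_add_neg, ← intVec_neg, hu]

lemma contDiff_torusPenalty {N : ℕ} : ContDiff ℝ 1 (torusPenalty (N := N)) := by
  unfold torusPenalty
  fun_prop

lemma isZPeriodic_torusPenalty {N : ℕ} : IsZPeriodic (torusPenalty (N := N)) := by
  intro x z
  unfold torusPenalty
  refine Finset.sum_congr rfl fun i _ => ?_
  rw [PiLp.add_apply, intVec_apply,
    show 2 * Real.pi * (x i + z i) = 2 * Real.pi * x i + z i * (2 * Real.pi) by ring,
    Real.cos_add_int_mul_two_pi]

lemma torusPenalty_nonneg {N : ℕ} (z : Euc N) : 0 ≤ torusPenalty z :=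
  Finset.sum_nonneg fun i _ => by linarith [Real.cos_le_one (2 * Real.pi * z i)]

lemma torusPenalty_zero {N : ℕ} : torusPenalty (0 : Euc N) = 0 := by
  simp [torusPenalty]

lemma torusPenalty_neg {N : ℕ} (z : Euc N) : torusPenalty (-z) = torusPenalty z := by
  simp [torusPenalty]

lemma torusPenaltyGrad_neg {N : ℕ} (z : Euc N) :
    torusPenaltyGrad (-z) = -torusPenaltyGrad z := by
  ext i; simp [torusPenaltyGrad]

lemma torusPenalty_le_card {N : ℕ} (z : Euc N) : torusPenalty z ≤ 2 * N := by
  calc torusPenalty z ≤ ∑ _i : Fin N, (2 : ℝ) :=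
        Finset.sum_le_sum fun i _ => by linarith [Real.neg_one_le_cos (2 * Real.pi * z i)]
    _ = 2 * N := by simp [mul_comm]

lemma torusPenalty_le_norm_sq {N : ℕ} (z : Euc N) :
    torusPenalty z ≤ 2 * Real.pi ^ 2 * ‖z‖ ^ 2 := by
  rw [EuclideanSpace.norm_sq_eq, Finset.mul_sum]
  refine Finset.sum_le_sum fun i _ => ?_
  have := Real.one_sub_sq_div_two_le_cos (x := 2 * Real.pi * z i)
  rw [Real.norm_eq_abs, sq_abs]
  nlinarith

lemma sqrt_torusPenalty_le_norm {N : ℕ} (z : Euc N) : √(torusPenalty z) ≤ 5 * ‖z‖ := by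
  refine Real.sqrt_le_iff.mpr ⟨by positivity, (torusPenalty_le_norm_sq z).trans ?_⟩
  have h1 := Real.pi_lt_d2
  have h2 := Real.pi_pos
  have h3 : Real.pi ^ 2 ≤ 12 := by nlinarith
  nlinarith [sq_nonneg ‖z‖]

lemma hasGradientAt_torusPenalty {N : ℕ} (z : Euc N) :
    HasGradientAt torusPenalty (torusPenaltyGrad z) z := by
  rw [hasGradientAt_iff_hasFDerivAt]
  have h : ∀ i : Fin N, HasFDerivAt (fun z : Euc N => 1 - Real.cos (2 * Real.pi * z i))
      ((2 * Real.pi * Real.sin (2 * Real.pi * z i)) • EuclideanSpace.proj (𝕜 := ℝ) i) z := by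
    intro i
    have h1 : HasFDerivAt (fun z : Euc N => z i) (EuclideanSpace.proj (𝕜 := ℝ) i) z :=
      (EuclideanSpace.proj (𝕜 := ℝ) i).hasFDerivAt
    refine (((h1.const_mul (2 * Real.pi)).cos).const_sub 1).congr_fderiv ?_
    ext v
    simp
    ring
  refine (HasFDerivAt.fun_sum (u := Finset.univ) fun i _ => h i).congr_fderiv ?_
  ext v
  simp [torusPenaltyGrad, PiLp.inner_apply, mul_comm]

lemma sqrt_torusPenalty_le_norm_grad {N : ℕ} (z : Euc N) (hz : torusPenalty z ≤ 1) :
    2 * Real.pi * √(torusPenalty z) ≤ ‖torusPenaltyGrad z‖ := by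
  refine abs_le_of_sq_le_sq' ?_ (norm_nonneg _) |>.2
  rw [mul_pow, Real.sq_sqrt (torusPenalty_nonneg z), EuclideanSpace.norm_sq_eq]
  unfold torusPenalty at hz ⊢
  rw [Finset.mul_sum]
  refine Finset.sum_le_sum fun i _ => ?_
  have h1 : 1 - Real.cos (2 * Real.pi * z i) ≤ 1 :=
    (Finset.single_le_sum (f := fun i => 1 - Real.cos (2 * Real.pi * z i))
      (fun j _ => by linarith [Real.cos_le_one (2 * Real.pi * z j)])
      (Finset.mem_univ i)).trans hz
  have h2 := Real.cos_le_one (2 * Real.pi * z i)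
  have h3 := Real.sin_sq_add_cos_sq (2 * Real.pi * z i)
  simp only [torusPenaltyGrad, Real.norm_eq_abs, sq_abs, mul_pow _ (Real.sin _)]
  refine mul_le_mul_of_nonneg_left ?_ (by positivity)
  nlinarith

lemma exists_intVec_norm_sub_le {N : ℕ} (x : Euc N) :
    ∃ z : Fin N → ℤ, ‖x - intVec z‖ ≤ √(torusPenalty x) := by
  refine ⟨fun i => round (x i), ?_⟩
  apply Real.le_sqrt_of_sq_le
  rw [EuclideanSpace.norm_sq_eq]
  refine Finset.sum_le_sum fun i _ => ?_
  rw [PiLp.sub_apply, intVec_apply, Real.norm_eq_abs, sq_abs]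
  set t := x i - round (x i) with ht
  have hcos : Real.cos (2 * Real.pi * x i) = Real.cos (2 * (Real.pi * t)) := by
    rw [ht, show 2 * (Real.pi * (x i - round (x i)))
      = 2 * Real.pi * x i - round (x i) * (2 * Real.pi) by ring, Real.cos_sub_int_mul_two_pi]
  have habs : |t| ≤ 1 / 2 := abs_sub_round (x i)
  have hpi := Real.pi_pos
  have hsin := Real.mul_abs_le_abs_sin (x := Real.pi * t) (by
    rw [abs_mul, abs_of_pos hpi]; nlinarith)
  rw [abs_mul, abs_of_pos hpi, ← mul_assoc, div_mul_cancel₀ _ hpi.ne'] at hsin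
  have h2 : t ^ 2 ≤ Real.sin (Real.pi * t) ^ 2 :=
    sq_le_sq.mpr (by linarith [abs_nonneg t])
  rw [hcos, Real.cos_two_mul]
  nlinarith [Real.sin_sq_add_cos_sq (Real.pi * t), sq_nonneg (Real.sin (Real.pi * t))]

lemma exists_intVec_norm_sub_le_card {N : ℕ} (x : Euc N) :
    ∃ z : Fin N → ℤ, ‖x - intVec z‖ ≤ 2 * N := by
  obtain ⟨z, hz⟩ := exists_intVec_norm_sub_le x
  refine ⟨z, hz.trans (Real.sqrt_le_iff.mpr ⟨by positivity, (torusPenalty_le_card x).trans ?_⟩)⟩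
  rcases Nat.eq_zero_or_pos N with h | h
  · simp [h]
  · have : (1 : ℝ) ≤ N := by exact_mod_cast h
    nlinarith

/-- A continuous function of two variables, periodic in each, attains its maximum. -/
lemma exists_forall_le_of_periodic₂ {N : ℕ} {F : Euc N → Euc N → ℝ}
    (hF : Continuous (fun w : Euc N × Euc N => F w.1 w.2))
    (h1 : ∀ y, IsZPeriodic fun x => F x y) (h2 : ∀ x, IsZPeriodic (F x)) :
    ∃ x y, ∀ x' y', F x' y' ≤ F x y := by
  let B := Metric.closedBall (0 : Euc N) (2 * N)
  have hB : IsCompact B := isCompact_closedBall _ _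
  have h0 : (0 : Euc N) ∈ B := Metric.mem_closedBall_self (by positivity)
  obtain ⟨w, -, hw⟩ := (hB.prod hB).exists_isMaxOn ⟨(0, 0), h0, h0⟩ hF.continuousOn
  refine ⟨w.1, w.2, fun x y => ?_⟩
  obtain ⟨z, hz⟩ := exists_intVec_norm_sub_le_card x
  obtain ⟨z', hz'⟩ := exists_intVec_norm_sub_le_card y
  have := hw (a := (x - intVec z, y - intVec z'))
    ⟨mem_closedBall_zero_iff.mpr hz, mem_closedBall_zero_iff.mpr hz'⟩
  simp only [mem_ofPred_eq] at this
  rwa [(h2 _).sub_intVec, (h1 _).sub_intVec] at this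

/-- A continuous periodic function attains its maximum. -/
lemma exists_forall_le_of_periodic {N : ℕ} {f : Euc N → ℝ}
    (hf : Continuous f) (hp : IsZPeriodic f) : ∃ x, ∀ y, f y ≤ f x := by
  obtain ⟨x, y, h⟩ := exists_forall_le_of_periodic₂ (F := fun x _ => f x)
    (by fun_prop) (fun _ => hp) (fun _ _ _ => rfl)
  exact ⟨x, fun x' => h x' x'⟩

lemma IsZPeriodic.exists_torus_modulus {N : ℕ} {σ : Euc N → ℝ} (hp : IsZPeriodic σ)
    (hc : Continuous σ) {ε : ℝ} (hε : 0 < ε) :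
    ∃ η > 0, ∀ x y, √(torusPenalty (x - y)) < η → |σ x - σ y| < ε := by
  have hu := (isCompact_closedBall (0 : Euc N) (2 * N + 1)).uniformContinuousOn_of_continuous
    hc.continuousOn
  rw [Metric.uniformContinuousOn_iff] at hu
  obtain ⟨η, hη, h⟩ := hu ε hε
  refine ⟨min η 1, by positivity, fun x y hxy => ?_⟩
  obtain ⟨z, hz⟩ := exists_intVec_norm_sub_le (x - y)
  obtain ⟨w, hw⟩ := exists_intVec_norm_sub_le_card x
  have hlt := hz.trans_lt hxy
  have hdist : dist (x - intVec w) (y + intVec z - intVec w) = ‖x - y - intVec z‖ := by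
    rw [dist_eq_norm]; congr 1; abel
  have := h (x - intVec w) (mem_closedBall_zero_iff.mpr (by linarith))
    (y + intVec z - intVec w) (mem_closedBall_zero_iff.mpr ?_)
    (hdist ▸ hlt.trans_le (min_le_left _ _))
  · rwa [hp.sub_intVec, hp.sub_intVec, hp, Real.dist_eq] at this
  · have h3 : y + intVec z - intVec w = (x - intVec w) - (x - y - intVec z) := by abel
    rw [h3]
    linarith [norm_sub_le (x - intVec w) (x - y - intVec z), hlt.trans_le (min_le_right _ _)]

lemma IsZPeriodic.sub_le_mul_sqrt_torusPenalty {N : ℕ} {u : Euc N → ℝ} (hp : IsZPeriodic u)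
    {K : NNReal} (hK : LipschitzWith K u) (x y : Euc N) :
    u x - u y ≤ K * √(torusPenalty (x - y)) := by
  obtain ⟨z, hz⟩ := exists_intVec_norm_sub_le (x - y)
  have h1 := hK.dist_le_mul x (y + intVec z)
  rw [hp, Real.dist_eq, dist_eq_norm, ← sub_sub] at h1
  exact (le_abs_self _).trans (h1.trans (by gcongr))

/-- A one-sided growth bound at a point controls the norm of the gradient there. -/
lemma norm_gradient_le_of_growth {N : ℕ} {φ : Euc N → ℝ} {x q : Euc N} {B C : ℝ}
    (hφ : HasGradientAt φ q x) (hB : 0 ≤ B)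
    (h : ∀ y, φ y - φ x ≤ B * ‖y - x‖ + C * ‖y - x‖ ^ 2) : ‖q‖ ≤ B := by
  by_cases hq : q = 0
  · simpa [hq] using hB
  have hq' : 0 < ‖q‖ := norm_pos_iff.mpr hq
  have hline : HasDerivAt (fun t : ℝ => x + t • q) q 0 := by
    simpa using ((hasDerivAt_id (0 : ℝ)).smul_const q).const_add x
  have hg : HasDerivAt (fun t : ℝ => φ (x + t • q)) (‖q‖ ^ 2) 0 := by
    have := HasFDerivAt.comp_hasDerivAt (f := fun t : ℝ => x + t • q) (0 : ℝ)
      (by simpa using hφ.hasFDerivAt) hline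
    simpa [Function.comp_def] using this
  have hbound : Tendsto (fun t : ℝ => B * ‖q‖ + C * ‖q‖ ^ 2 * t) (nhdsWithin 0 (Ioi 0))
      (nhds (B * ‖q‖ + C * ‖q‖ ^ 2 * 0)) :=
    (Continuous.tendsto (by fun_prop) 0).mono_left nhdsWithin_le_nhds
  have hle : ‖q‖ ^ 2 ≤ B * ‖q‖ + C * ‖q‖ ^ 2 * 0 := by
    refine le_of_tendsto_of_tendsto hg.tendsto_slope_zero_right hbound ?_
    filter_upwards [self_mem_nhdsWithin] with t ht
    have ht : 0 < t := ht
    have := h (x + t • q)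
    rw [add_sub_cancel_left, norm_smul, Real.norm_eq_abs, abs_of_pos ht] at this
    simp only [zero_add, zero_smul, add_zero, smul_eq_mul]
    rw [inv_mul_le_iff₀ ht]
    linarith
  nlinarith

lemma hasGradientAt_comp_torusPenalty {N : ℕ} {g : ℝ → ℝ} {g' : ℝ} {x y : Euc N}
    (hg : HasDerivAt g g' (torusPenalty (x - y))) :
    HasGradientAt (fun x => g (torusPenalty (x - y))) (g' • torusPenaltyGrad (x - y)) x := by
  have h1 : HasFDerivAt (fun x : Euc N => torusPenalty (x - y))
      (InnerProductSpace.toDual ℝ (Euc N) (torusPenaltyGrad (x - y))) x :=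
    (hasFDerivAt_comp_sub y).mpr (hasGradientAt_torusPenalty (x - y)).hasFDerivAt
  rw [hasGradientAt_iff_hasFDerivAt]
  refine (hg.comp_hasFDerivAt x h1).congr_fderiv ?_
  ext v
  simp

lemma isZPeriodic_comp_torusPenalty {N : ℕ} (g : ℝ → ℝ) (y : Euc N) :
    IsZPeriodic fun x => g (torusPenalty (x - y)) := by
  intro x z
  simp only [add_sub_right_comm, isZPeriodic_torusPenalty _ z]

lemma IsZPeriodic.sub_comp_torusPenalty {N : ℕ} {u : Euc N → ℝ} (hu : IsZPeriodic u)
    (g : ℝ → ℝ) (y : Euc N) : IsZPeriodic fun x => u x - g (torusPenalty (x - y)) := by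
  intro x z
  simp only [hu x z, isZPeriodic_comp_torusPenalty g y x z]

lemma smul_torusPenaltyGrad_mem_superDiff {N : ℕ} {u : Euc N → ℝ} {g : ℝ → ℝ} {g' : ℝ}
    {x y : Euc N} (hg : HasDerivAt g g' (torusPenalty (x - y)))
    (hC : ContDiff ℝ 1 fun x => g (torusPenalty (x - y)))
    (hmax : ∀ w, u w - g (torusPenalty (w - y)) ≤ u x - g (torusPenalty (x - y))) :
    g' • torusPenaltyGrad (x - y) ∈ superDiff u x :=
  ⟨_, hC, isZPeriodic_comp_torusPenalty g y, hmax,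
    (hasGradientAt_comp_torusPenalty hg).gradient.symm⟩

lemma neg_mem_subDiff_iff {N : ℕ} {u : Euc N → ℝ} {x q : Euc N} :
    -q ∈ subDiff u x ↔ q ∈ superDiff (-u) x := by
  have key : ∀ (φ : Euc N → ℝ), gradient (-φ) x = -gradient φ x := by
    intro φ
    simp only [gradient, fderiv_neg, map_neg]
  constructor
  · rintro ⟨φ, h1, h2, h3, h4⟩
    refine ⟨-φ, h1.neg, fun y z => by simp [h2 y z], fun y => ?_, ?_⟩
    · simpa using by linarith [h3 y]
    · rw [key, ← h4, neg_neg]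
  · rintro ⟨φ, h1, h2, h3, h4⟩
    refine ⟨-φ, h1.neg, fun y z => by simp [h2 y z], fun y => ?_, ?_⟩
    · have := h3 y
      simp only [Pi.neg_apply] at this ⊢
      linarith
    · rw [key, ← h4]

lemma norm_le_of_mem_subDiff {N : ℕ} {u : Euc N → ℝ} {x q : Euc N} {B C : ℝ} (hB : 0 ≤ B)
    (h : ∀ y, u y - u x ≤ B * ‖y - x‖ + C * ‖y - x‖ ^ 2) (hq : q ∈ subDiff u x) :
    ‖q‖ ≤ B := by
  obtain ⟨φ, h1, -, h3, rfl⟩ := hq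
  exact norm_gradient_le_of_growth (C := C)
    ((h1.differentiable one_ne_zero) x).hasGradientAt hB fun y => by linarith [h y, h3 y]

lemma LipschitzWith.norm_le_of_mem_subDiff {N : ℕ} {u : Euc N → ℝ} {K : NNReal}
    (hK : LipschitzWith K u) {x q : Euc N} (hq : q ∈ subDiff u x) : ‖q‖ ≤ K := by
  refine _root_.norm_le_of_mem_subDiff (C := 0) K.2 (fun y => ?_) hq
  have := hK.dist_le_mul y x
  rw [Real.dist_eq, dist_eq_norm] at this
  simpa using (le_abs_self _).trans this

lemma LipschitzWith.norm_le_of_mem_superDiff {N : ℕ} {u : Euc N → ℝ} {K : NNReal}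
    (hK : LipschitzWith K u) {x q : Euc N} (hq : q ∈ superDiff u x) : ‖q‖ ≤ K := by
  rw [← norm_neg]
  refine LipschitzWith.norm_le_of_mem_subDiff (u := -u) hK.neg (x := x) ?_
  rwa [neg_mem_subDiff_iff, neg_neg]

lemma mul_sqrt_le_of_mul_le_mul_sqrt {A K s : ℝ} (hs : 0 ≤ s) (hK : 0 ≤ K)
    (h : A * s ≤ K * √s) : A * √s ≤ K := by
  rcases (Real.sqrt_nonneg s).eq_or_lt with h0 | h0
  · simpa [← h0] using hK
  · have : A * √s * √s ≤ K * √s := by rwa [mul_assoc, Real.mul_self_sqrt hs]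
    exact le_of_mul_le_mul_right this h0

/-- If all superdifferentials of a Lipschitz periodic function lie in the ball of radius `R`,
then its subdifferentials lie in the ball of radius `5 * R`. -/
lemma norm_le_of_mem_subDiff_of_superDiff_bounded {N : ℕ} {u : Euc N → ℝ} {K : NNReal}
    (hK : LipschitzWith K u) (hp : IsZPeriodic u) {R : ℝ} (hR : 0 < R)
    (hsup : ∀ x, ∀ q ∈ superDiff u x, ‖q‖ ≤ R) {x q : Euc N} (hq : q ∈ subDiff u x) :
    ‖q‖ ≤ 5 * R := by
  have hK0 : (0 : ℝ) ≤ K := K.2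
  have hgrowth : ∀ δ : ℝ, 0 < δ → ∀ y, u y - u x ≤
      R * √(torusPenalty (y - x)) + (K + 1) * torusPenalty (y - x) + (K + R) * δ := by
    intro δ hδ y
    let g : ℝ → ℝ := fun s => R * √(δ ^ 2 + s) + (K + 1) * s
    have hpos : ∀ w, 0 < δ ^ 2 + torusPenalty (w - x) := fun w => by
      have := torusPenalty_nonneg (w - x)
      positivity
    have hψC : ContDiff ℝ 1 fun w : Euc N => torusPenalty (w - x) :=
      contDiff_torusPenalty.comp (contDiff_id.sub contDiff_const)
    have hgC : ContDiff ℝ 1 fun w => g (torusPenalty (w - x)) :=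
      (contDiff_const.mul ((contDiff_const.add hψC).sqrt fun w => (hpos w).ne')).add
        (contDiff_const.mul hψC)
    obtain ⟨x₀, hx₀⟩ := exists_forall_le_of_periodic
      (f := fun w => u w - g (torusPenalty (w - x))) (hK.continuous.sub hgC.continuous)
      (hp.sub_comp_torusPenalty g x)
    set s := torusPenalty (x₀ - x) with hs
    have hs0 : 0 ≤ s := torusPenalty_nonneg _
    have hr0 := Real.sqrt_nonneg s
    have hrs := Real.mul_self_sqrt hs0
    have hD : δ ≤ √(δ ^ 2 + s) := Real.le_sqrt_of_sq_le (by linarith)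
    have hDs : √(δ ^ 2 + s) ≤ δ + √s := Real.sqrt_le_iff.mpr ⟨by positivity, by nlinarith⟩
    have hux := hp.sub_le_mul_sqrt_torusPenalty hK x₀ x
    rw [← hs] at hux
    have hs1 : s ≤ 1 := by
      have h1 := hx₀ x
      simp only [g, sub_self, torusPenalty_zero, add_zero, Real.sqrt_sq hδ.le, mul_zero] at h1
      have h2 := mul_sqrt_le_of_mul_le_mul_sqrt (A := K + 1) hs0 hK0 (by nlinarith)
      have h3 : √s ≤ 1 := by
        by_contra! h
        nlinarith
      nlinarith
    have hsδ : √s ≤ δ := by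
      have hgd : HasDerivAt g (R * (1 / (2 * √(δ ^ 2 + s))) + (K + 1) * 1) s :=
        ((((hasDerivAt_id s).const_add (δ ^ 2)).sqrt (hpos x₀).ne').const_mul R).add
          ((hasDerivAt_id s).const_mul _)
      have h1 := hsup x₀ _ (smul_torusPenaltyGrad_mem_superDiff hgd hgC hx₀)
      have hDpos : 0 < √(δ ^ 2 + s) := hδ.trans_le hD
      rw [norm_smul, Real.norm_eq_abs, abs_of_nonneg (by positivity)] at h1
      have h2 := sqrt_torusPenalty_le_norm_grad (x₀ - x) hs1
      rw [← hs] at h2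
      have h3 : R * (1 / (2 * √(δ ^ 2 + s))) * (2 * Real.pi * √s) ≤ R := by
        refine le_trans ?_ h1
        refine mul_le_mul (by linarith) h2 (by positivity) (by positivity)
      have h4 : R * (1 / (2 * √(δ ^ 2 + s))) * (2 * Real.pi * √s)
          = R * (Real.pi * √s / √(δ ^ 2 + s)) := by field_simp
      rw [h4] at h3
      have h5 : Real.pi * √s / √(δ ^ 2 + s) ≤ 1 := by
        by_contra! h
        nlinarith
      rw [div_le_one hDpos] at h5
      nlinarith [Real.pi_gt_three]
    have hy := hx₀ y
    set t := torusPenalty (y - x) with ht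
    have ht0 : 0 ≤ t := torusPenalty_nonneg _
    have hDt : √(δ ^ 2 + t) ≤ δ + √t := by
      have := Real.mul_self_sqrt ht0
      have := Real.sqrt_nonneg t
      exact Real.sqrt_le_iff.mpr ⟨by positivity, by nlinarith⟩
    simp only [g] at hy
    have e1 : R * √(δ ^ 2 + t) ≤ R * (δ + √t) := by gcongr
    have e2 : 0 ≤ R * √(δ ^ 2 + s) + (K + 1) * s := by positivity
    have e3 : K * √s ≤ K * δ := by gcongr
    linarith
  refine norm_le_of_mem_subDiff (C := (K + 1) * (2 * Real.pi ^ 2)) (by positivity)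
    (fun y => ?_) hq
  have h1 : u y - u x ≤ R * √(torusPenalty (y - x)) + (K + 1) * torusPenalty (y - x) := by
    refine le_of_forall_pos_le_add fun ε hε => ?_
    have := hgrowth (ε / (K + R)) (by positivity) y
    rwa [mul_div_cancel₀ _ (by positivity)] at this
  have h2 : R * √(torusPenalty (y - x)) ≤ R * (5 * ‖y - x‖) := by
    gcongr
    exact sqrt_torusPenalty_le_norm _
  have h3 : (K + 1) * torusPenalty (y - x) ≤ (K + 1) * (2 * Real.pi ^ 2 * ‖y - x‖ ^ 2) := by
    gcongr
    exact torusPenalty_le_norm_sq _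
  linarith

/-- Comparison of the constants of a subsolution and a supersolution. -/
lemma le_of_subsolution_of_supersolution {N : ℕ} {σ : Euc N → ℝ} {h : ℝ → ℝ}
    (hσc : Continuous σ) (hσp : IsZPeriodic σ) (hh0 : ∀ r, 0 ≤ r → 0 ≤ h r)
    (hh : ∀ R, ∃ C, ∀ r, 0 ≤ r → r ≤ R → h r ≤ C)
    {P : Euc N} {a b : ℝ} {u v : Euc N → ℝ}
    {K : NNReal} (huK : LipschitzWith K u) (hup : IsZPeriodic u)
    (hu : IsCellSubsolution (fun x p => σ x * h ‖p‖) P a u)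
    (hvc : Continuous v) (hvp : IsZPeriodic v)
    (hv : IsCellSupersolution (fun x p => σ x * h ‖p‖) P b v) : b ≤ a := by
  refine le_of_forall_pos_le_add fun ε hε => ?_
  obtain ⟨C, hC⟩ := hh (K + ‖P‖)
  have hK0 : (0 : ℝ) ≤ K := K.2
  have hC0 : 0 ≤ C := (hh0 0 le_rfl).trans (hC 0 le_rfl (by positivity))
  obtain ⟨η, hη, hmod⟩ := hσp.exists_torus_modulus hσc (ε := ε / (C + 1)) (by positivity)
  let A : ℝ := (K + 1) / η
  have hA : 0 < A := by positivity
  have hψC : ∀ y, ContDiff ℝ 1 fun w : Euc N => torusPenalty (w - y) := fun y =>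
    contDiff_torusPenalty.comp (contDiff_id.sub contDiff_const)
  obtain ⟨x, y, hxy⟩ := exists_forall_le_of_periodic₂
    (F := fun x y => u x - v y - A * torusPenalty (x - y))
    (((huK.continuous.comp continuous_fst).sub (hvc.comp continuous_snd)).sub
      (continuous_const.mul (contDiff_torusPenalty.continuous.comp
        (continuous_fst.sub continuous_snd))))
    (fun y x z => by simp only [hup x z, add_sub_right_comm, isZPeriodic_torusPenalty _ z])
    (fun x y z => by
      simp only [hvp y z, ← sub_sub x, isZPeriodic_torusPenalty.sub_intVec (x - y) z])
  have hsup : A • torusPenaltyGrad (x - y) ∈ superDiff u x :=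
    smul_torusPenaltyGrad_mem_superDiff (g := fun s => A * s)
      (by simpa using (hasDerivAt_id (torusPenalty (x - y))).const_mul A)
      (contDiff_const.mul (hψC y)) (fun w => by linarith [hxy w y])
  have hsub : A • torusPenaltyGrad (x - y) ∈ subDiff v y := by
    rw [← neg_sub y x, torusPenaltyGrad_neg, smul_neg, neg_mem_subDiff_iff]
    refine smul_torusPenaltyGrad_mem_superDiff (g := fun s => A * s)
      (by simpa using (hasDerivAt_id (torusPenalty (y - x))).const_mul A)
      (contDiff_const.mul (hψC x)) (fun w => ?_)
    have := hxy x w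
    rw [← torusPenalty_neg (x - w), ← torusPenalty_neg (x - y), neg_sub, neg_sub] at this
    simp only [Pi.neg_apply]
    linarith
  have hclose : A * √(torusPenalty (x - y)) ≤ K := by
    refine mul_sqrt_le_of_mul_le_mul_sqrt (torusPenalty_nonneg _) hK0 ?_
    have h1 := hxy y y
    rw [sub_self, torusPenalty_zero] at h1
    linarith [hup.sub_le_mul_sqrt_torusPenalty huK x y]
  have hlt : √(torusPenalty (x - y)) < η := by
    by_contra! h
    have : A * η ≤ K := (mul_le_mul_of_nonneg_left h hA.le).trans hclose
    rw [div_mul_cancel₀ _ hη.ne'] at this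
    linarith
  have hσ := hmod x y hlt
  have h1 : σ x * h ‖_‖ ≤ a := hu x _ hsup
  have h2 : b ≤ σ y * h ‖_‖ := hv y _ hsub
  set p := A • torusPenaltyGrad (x - y) + P with hpdef
  have hp1 : ‖p‖ ≤ K + ‖P‖ :=
    (norm_add_le _ _).trans (by gcongr; exact huK.norm_le_of_mem_superDiff hsup)
  have h3 := hC _ (norm_nonneg p) hp1
  have h4 := hh0 _ (norm_nonneg p)
  have h5 : σ y - σ x ≤ ε / (C + 1) := by linarith [neg_abs_le (σ x - σ y)]
  have h6 : (σ y - σ x) * h ‖p‖ ≤ ε / (C + 1) * (C + 1) :=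
    mul_le_mul h5 (by linarith) h4 (by positivity)
  rw [div_mul_cancel₀ _ (by positivity)] at h6
  linarith

/-- Subdifferentials of a Lipschitz periodic function are nonempty on a dense set. -/
lemma exists_subDiff_near {N : ℕ} {u : Euc N → ℝ} {K : NNReal} (hK : LipschitzWith K u)
    (hp : IsZPeriodic u) (x : Euc N) {η : ℝ} (hη : 0 < η) :
    ∃ y, √(torusPenalty (y - x)) < η ∧ (subDiff u y).Nonempty := by
  have hK0 : (0 : ℝ) ≤ K := K.2
  let A : ℝ := (K + 1) / η
  have hA : 0 < A := by positivity
  have hψC : ContDiff ℝ 1 fun w : Euc N => torusPenalty (w - x) :=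
    contDiff_torusPenalty.comp (contDiff_id.sub contDiff_const)
  obtain ⟨y, hy⟩ := exists_forall_le_of_periodic
    (f := fun w => (-u) w - A * torusPenalty (w - x))
    (hK.continuous.neg.sub (continuous_const.mul hψC.continuous))
    (IsZPeriodic.sub_comp_torusPenalty (fun w z => by simp [hp w z]) (fun s => A * s) x)
  refine ⟨y, ?_, _, neg_mem_subDiff_iff.mpr (smul_torusPenaltyGrad_mem_superDiff
    (g := fun s => A * s) (by simpa using (hasDerivAt_id (torusPenalty (y - x))).const_mul A)
    (contDiff_const.mul hψC) hy)⟩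
  have hclose : A * √(torusPenalty (y - x)) ≤ K := by
    refine mul_sqrt_le_of_mul_le_mul_sqrt (torusPenalty_nonneg _) hK0 ?_
    have h1 := hy x
    simp only [sub_self, torusPenalty_zero, Pi.neg_apply] at h1
    have h2 := hp.sub_le_mul_sqrt_torusPenalty hK x y
    rw [← torusPenalty_neg, neg_sub] at h2
    linarith
  by_contra! h
  have : A * η ≤ K := (mul_le_mul_of_nonneg_left h hA.le).trans hclose
  rw [div_mul_cancel₀ _ hη.ne'] at this
  linarith

/-- The constant of a Lipschitz solution lies strictly below the minimum of `σ`. -/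
lemma IsCellSolution.lt_of_isLeast {N : ℕ} {σ : Euc N → ℝ} {m : ℝ → ℝ}
    (hσc : Continuous σ) (hσp : IsZPeriodic σ) (hσpos : ∀ x, 0 < σ x)
    (hm01 : ∀ r : ℝ, 0 ≤ r → 0 < m r ∧ m r < 1) (hmmono : StrictMonoOn m (Set.Ici 0))
    {σmin : ℝ} (hσmin : IsLeast (Set.range σ) σmin) {P : Euc N} {u : Euc N → ℝ} {a : ℝ}
    (hu : IsCellSolution (fun x p => σ x * m ‖p‖) P u a) : a < σmin := by
  obtain ⟨⟨K, hK⟩, hp, -, hsup⟩ := hu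
  obtain ⟨⟨x₀, hx₀⟩, -⟩ := hσmin
  have hK0 : (0 : ℝ) ≤ K := K.2
  obtain ⟨hM0, hM1⟩ := hm01 (K + ‖P‖) (by positivity)
  have hpos : 0 < σmin := hx₀ ▸ hσpos x₀
  have hle : a ≤ σmin * m (K + ‖P‖) := by
    refine le_of_forall_pos_le_add fun ε hε => ?_
    obtain ⟨η, hη, hmod⟩ := hσp.exists_torus_modulus hσc hε
    obtain ⟨y, hy, q, hq⟩ := exists_subDiff_near hK hp x₀ hη
    have h1 : a ≤ σ y * m ‖q + P‖ := hsup y q hq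
    have h2 : ‖q + P‖ ≤ K + ‖P‖ :=
      (norm_add_le _ _).trans (by gcongr; exact hK.norm_le_of_mem_subDiff hq)
    have h3 : m ‖q + P‖ ≤ m (K + ‖P‖) :=
      hmmono.monotoneOn (norm_nonneg _) ((norm_nonneg _).trans h2) h2
    have h4 : σ y ≤ σmin + ε := by
      rw [← hx₀]
      linarith [le_abs_self (σ y - σ x₀), hmod y x₀ hy]
    have h5 : σ y * m ‖q + P‖ ≤ (σmin + ε) * m (K + ‖P‖) :=
      mul_le_mul h4 h3 (hm01 _ (norm_nonneg _)).1.le (by positivity)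
    nlinarith
  nlinarith

/-- The cell problem only depends on the values of the Hamiltonian on the sub- and
superdifferentials. -/
lemma IsCellSolution.congr {N : ℕ} {G H : Euc N → Euc N → ℝ} {P : Euc N} {u : Euc N → ℝ} {a : ℝ}
    (hu : IsCellSolution G P u a) {B : ℝ} (hsup : ∀ x, ∀ q ∈ superDiff u x, ‖q‖ ≤ B)
    (hsub : ∀ x, ∀ q ∈ subDiff u x, ‖q‖ ≤ B)
    (hGH : ∀ x q, ‖q‖ ≤ B → G x (q + P) = H x (q + P)) : IsCellSolution H P u a :=
  ⟨hu.1, hu.2.1, fun x q hq => hGH x q (hsup x q hq) ▸ hu.2.2.1 x q hq,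
    fun x q hq => hGH x q (hsub x q hq) ▸ hu.2.2.2 x q hq⟩

lemma max_truncation_eq {m : ℝ → ℝ} {L : NNReal} (hm : ∀ r : ℝ, 0 ≤ r → 0 < m r)
    {N n : ℕ} {P q : Euc N} {B : ℝ} (hn : L * (B + ‖P‖) ≤ n) (hq : ‖q‖ ≤ B) :
    max (m ‖q + P‖) (L * ‖q + P‖ - n) = m ‖q + P‖ := by
  refine max_eq_left (le_trans ?_ (hm _ (norm_nonneg _)).le)
  have : L * ‖q + P‖ ≤ L * (B + ‖P‖) := by
    gcongr
    exact (norm_add_le _ _).trans (by gcongr)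
  linarith

/-- Characterization of the solvability set
`D = {P : H̄_∞(P) < σ̲}`, and on `D` the critical value equals `H̄_∞(P)`.
Here `H̄_∞(P)` is realized as the limit of the critical values `c n P` of the
coercive approximations `H_n(x,p) = σ(x)·max{m(|p|), L|p| − n}`. -/
theorem solvability_set_characterization {N : ℕ} (hN : 1 ≤ N)
    (σ : Euc N → ℝ) (m : ℝ → ℝ) (L : NNReal)
    (hσc : Continuous σ) (hσp : IsZPeriodic σ) (hσpos : ∀ x, 0 < σ x)
    (hm01 : ∀ r : ℝ, 0 ≤ r → 0 < m r ∧ m r < 1)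
    (hmLip : LipschitzOnWith L m (Set.Ici 0))
    (hmmono : StrictMonoOn m (Set.Ici 0))
    (hmlim : Tendsto m atTop (nhds 1))
    (σmin : ℝ) (hσmin : IsLeast (Set.range σ) σmin)
    (c : ℕ → Euc N → ℝ)
    (hc : ∀ (n : ℕ) (P : Euc N), ∃ u : Euc N → ℝ,
        IsCellSolution (fun x p => σ x * max (m ‖p‖) ((L : ℝ) * ‖p‖ - n)) P u (c n P))
    (Hinf : Euc N → ℝ)
    (hHinf : ∀ P : Euc N, Tendsto (fun n => c n P) atTop (nhds (Hinf P))) :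
    { P : Euc N | ∃ (u : Euc N → ℝ) (a : ℝ),
        IsCellSolution (fun x p => σ x * m ‖p‖) P u a }
      = { P : Euc N | Hinf P < σmin } ∧
    ∀ (P : Euc N) (u : Euc N → ℝ) (a : ℝ),
      IsCellSolution (fun x p => σ x * m ‖p‖) P u a → a = Hinf P := by
  have hm0 : ∀ r : ℝ, 0 ≤ r → 0 < m r := fun r hr => (hm01 r hr).1
  have huniq : ∀ (P : Euc N) (u : Euc N → ℝ) (a : ℝ),
      IsCellSolution (fun x p => σ x * m ‖p‖) P u a → a = Hinf P := by
    intro P u a hu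
    obtain ⟨K, hK⟩ := hu.1
    refine tendsto_nhds_unique (tendsto_const_nhds.congr' ?_) (hHinf P)
    obtain ⟨n₀, hn₀⟩ := exists_nat_ge (L * (K + ‖P‖) : ℝ)
    filter_upwards [eventually_ge_atTop n₀] with n hn
    have hn' : (L * (K + ‖P‖) : ℝ) ≤ n := hn₀.trans (by exact_mod_cast hn)
    have hun : IsCellSolution (fun x p => σ x * max (m ‖p‖) ((L : ℝ) * ‖p‖ - n)) P u a :=
      hu.congr (fun x q hq => hK.norm_le_of_mem_superDiff hq)
        (fun x q hq => hK.norm_le_of_mem_subDiff hq)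
        (fun x q hq => by simp only [max_truncation_eq hm0 hn' hq])
    obtain ⟨v, hv⟩ := hc n P
    obtain ⟨K', hK'⟩ := hv.1
    have hh0 : ∀ r : ℝ, 0 ≤ r → 0 ≤ max (m r) (L * r - n) := fun r hr =>
      le_max_of_le_left (hm0 r hr).le
    have hh : ∀ R : ℝ, ∃ C : ℝ, ∀ r, 0 ≤ r → r ≤ R → max (m r) (L * r - n) ≤ C := fun R =>
      ⟨max 1 (L * R - n), fun r hr hrR => max_le_max (hm01 r hr).2.le (by gcongr)⟩
    exact le_antisymm
      (le_of_subsolution_of_supersolution hσc hσp hh0 hh hK' hv.2.1 hv.2.2.1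
        hK.continuous hun.2.1 hun.2.2.2)
      (le_of_subsolution_of_supersolution hσc hσp hh0 hh hK hun.2.1 hun.2.2.1
        hK'.continuous hv.2.1 hv.2.2.2)
  refine ⟨Set.ext fun P => ⟨?_, fun hP => ?_⟩, huniq⟩
  · rintro ⟨u, a, hu⟩
    have := hu.lt_of_isLeast hσc hσp hσpos hm01 hmmono hσmin
    rwa [huniq P u a hu] at this
  · have hP : Hinf P < σmin := hP
    obtain ⟨s, hs1, hs2⟩ := exists_between hP
    have hpos : 0 < σmin := by
      obtain ⟨⟨x₀, hx₀⟩, -⟩ := hσmin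
      exact hx₀ ▸ hσpos x₀
    obtain ⟨R, hR, hmR⟩ : ∃ R : ℝ, 0 ≤ R ∧ s / σmin < m R := by
      have h1 : s / σmin < 1 := (div_lt_one hpos).mpr hs2
      exact ((eventually_ge_atTop 0).and (hmlim.eventually (lt_mem_nhds h1))).exists
    obtain ⟨n₀, hn₀⟩ := exists_nat_ge (L * (5 * (R + ‖P‖ + 1) + ‖P‖) : ℝ)
    obtain ⟨n, hcn, hn⟩ := (((hHinf P).eventually (gt_mem_nhds hs1)).and
      (eventually_ge_atTop n₀)).exists
    have hn' : (L * (5 * (R + ‖P‖ + 1) + ‖P‖) : ℝ) ≤ n := hn₀.trans (by exact_mod_cast hn)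
    obtain ⟨u, hu⟩ := hc n P
    obtain ⟨K, hK⟩ := hu.1
    have hsup : ∀ x, ∀ q ∈ superDiff u x, ‖q‖ ≤ R + ‖P‖ + 1 := by
      intro x q hq
      have h1 : σ x * max (m ‖q + P‖) (L * ‖q + P‖ - n) ≤ c n P := hu.2.2.1 x q hq
      have h2 : σmin * m ‖q + P‖ ≤ σ x * max (m ‖q + P‖) (L * ‖q + P‖ - n) :=
        mul_le_mul (hσmin.2 ⟨x, rfl⟩) (le_max_left _ _) (hm0 _ (norm_nonneg _)).le (hσpos x).le
      have h3 : m ‖q + P‖ < m R := by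
        refine lt_trans ?_ hmR
        rw [lt_div_iff₀ hpos]
        linarith
      have h4 : ‖q + P‖ < R := (hmmono.lt_iff_lt (norm_nonneg _) hR).mp h3
      have h5 := norm_sub_le (q + P) P
      rw [add_sub_cancel_right] at h5
      linarith
    have hpos' : 0 < R + ‖P‖ + 1 := by positivity
    exact ⟨u, c n P, hu.congr (B := 5 * (R + ‖P‖ + 1))
      (fun x q hq => (hsup x q hq).trans (by linarith))
      (fun x q hq => norm_le_of_mem_subDiff_of_superDiff_bounded hK hu.2.1 hpos' hsup hq)
      (fun x q hq => by simp only [max_truncation_eq hm0 hn' hq])⟩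
end
end

section
/- Bounds on the generalized effective Hamiltonian: For every P ∈ ℝ^N, max{σ̲ m(|P|), σ̄ m₀} ≤ H̄_∞(P) ≤ σ̄ m(|P|) < σ̄. -/
open Set Filter MeasureTheory

noncomputable section

theorem exists_add_intVec_mem_cube {N : ℕ} (x₀ y : Euc N) :
    ∃ z : Fin N → ℤ, ∀ i, |(y + intVec z) i - x₀ i| ≤ 1 / 2 := by
  refine ⟨fun i => -round (y i - x₀ i), fun i => ?_⟩
  have h := abs_sub_round (y i - x₀ i)
  have e : (y + intVec (fun i => -round (y i - x₀ i))) i - x₀ i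
      = y i - x₀ i - round (y i - x₀ i) := by
    simp [intVec]
    ring
  rwa [e]

theorem isCompact_cube {N : ℕ} (x₀ : Euc N) :
    IsCompact {x : Euc N | ∀ i, |x i - x₀ i| ≤ 1 / 2} := by
  have hK : IsCompact (Set.univ.pi fun i : Fin N => Metric.closedBall (x₀ i) (1 / 2)) :=
    isCompact_univ_pi fun i => isCompact_closedBall _ _
  convert hK.image (EuclideanSpace.equiv (Fin N) ℝ).symm.continuous using 1
  ext x
  simp only [Set.mem_ofPred_eq, Set.mem_image, Set.mem_univ_pi, Metric.mem_closedBall,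
    Real.dist_eq]
  constructor
  · intro h
    exact ⟨EuclideanSpace.equiv (Fin N) ℝ x, fun i => h i, by simp⟩
  · rintro ⟨y, hy, rfl⟩ i
    exact hy i

/-- A continuous periodic function attains its global maximum in every closed unit cube. -/
theorem IsZPeriodic.exists_max_mem_cube {N : ℕ} {f : Euc N → ℝ} (hf : Continuous f)
    (hp : IsZPeriodic f) (x₀ : Euc N) :
    ∃ x : Euc N, (∀ i, |x i - x₀ i| ≤ 1 / 2) ∧ ∀ y, f y ≤ f x := by
  obtain ⟨x, hx, hmax⟩ := (isCompact_cube x₀).exists_isMaxOn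
    ⟨x₀, fun i => by simp⟩ hf.continuousOn
  refine ⟨x, hx, fun y => ?_⟩
  obtain ⟨z, hz⟩ := exists_add_intVec_mem_cube x₀ y
  rw [← hp y z]
  exact hmax hz

theorem zero_mem_superDiff {N : ℕ} {u : Euc N → ℝ} {x : Euc N} (h : ∀ y, u y ≤ u x) :
    (0 : Euc N) ∈ superDiff u x :=
  ⟨fun _ => 0, contDiff_const, fun _ _ => rfl, fun y => by simpa using h y,
    by simp [gradient]⟩

theorem zero_mem_subDiff {N : ℕ} {u : Euc N → ℝ} {x : Euc N} (h : ∀ y, u x ≤ u y) :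
    (0 : Euc N) ∈ subDiff u x :=
  ⟨fun _ => 0, contDiff_const, fun _ _ => rfl, fun y => by simpa using h y,
    by simp [gradient]⟩

/-- A smooth periodic substitute for the squared distance to `x₀`. -/
def periodicBump {N : ℕ} (x₀ x : Euc N) : ℝ :=
  ∑ i, (1 - Real.cos (2 * Real.pi * (x i - x₀ i)))

theorem contDiff_periodicBump {N : ℕ} (x₀ : Euc N) : ContDiff ℝ 1 (periodicBump x₀) := by
  unfold periodicBump
  fun_prop

theorem isZPeriodic_periodicBump {N : ℕ} (x₀ : Euc N) : IsZPeriodic (periodicBump x₀) := by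
  intro x z
  refine Finset.sum_congr rfl fun i _ => ?_
  have e : 2 * Real.pi * ((x + intVec z) i - x₀ i)
      = 2 * Real.pi * (x i - x₀ i) + z i * (2 * Real.pi) := by
    simp [intVec]
    ring
  rw [e, Real.cos_add_int_mul_two_pi]

theorem periodicBump_self {N : ℕ} (x₀ : Euc N) : periodicBump x₀ x₀ = 0 := by
  simp [periodicBump]

theorem norm_sq_le_periodicBump {N : ℕ} {x₀ x : Euc N} (h : ∀ i, |x i - x₀ i| ≤ 1 / 2) :
    8 * ‖x - x₀‖ ^ 2 ≤ periodicBump x₀ x := by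
  rw [EuclideanSpace.norm_sq_eq, Finset.mul_sum]
  refine Finset.sum_le_sum fun i _ => ?_
  have hpi := Real.pi_pos
  have hle : |2 * Real.pi * (x i - x₀ i)| ≤ Real.pi := by
    rw [abs_mul, abs_of_pos (by positivity)]
    nlinarith [h i]
  have hcos := Real.cos_le_one_sub_mul_cos_sq hle
  have e : 2 / Real.pi ^ 2 * (2 * Real.pi * (x i - x₀ i)) ^ 2 = 8 * (x i - x₀ i) ^ 2 := by
    field_simp
    ring
  rw [e] at hcos
  rw [Real.norm_eq_abs, sq_abs, PiLp.sub_apply]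
  linarith

/-- Points with nonempty superdifferential accumulate at every point. -/
theorem exists_superDiff_nonempty_near {N : ℕ} {u : Euc N → ℝ} {K : NNReal}
    (hu : LipschitzWith K u) (hp : IsZPeriodic u) (x₀ : Euc N) {k : ℝ} (hk : 0 < k) :
    ∃ x, ‖x - x₀‖ ≤ K / (8 * k) ∧ (superDiff u x).Nonempty := by
  have hφ : ContDiff ℝ 1 fun x => k * periodicBump x₀ x :=
    contDiff_const.mul (contDiff_periodicBump x₀)
  have hφp : IsZPeriodic fun x => k * periodicBump x₀ x := fun x z => by
    simp only [isZPeriodic_periodicBump x₀ x z]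
  obtain ⟨x, hx, hmax⟩ := IsZPeriodic.exists_max_mem_cube
    (f := fun x => u x - k * periodicBump x₀ x) (hu.continuous.sub hφ.continuous)
    (fun x z => by simp only [hp x z, isZPeriodic_periodicBump x₀ x z]) x₀
  refine ⟨x, ?_, _, _, hφ, hφp, hmax, rfl⟩
  have h₀ := hmax x₀
  simp only [periodicBump_self] at h₀
  have hlip : u x - u x₀ ≤ K * ‖x - x₀‖ := by
    have := hu.dist_le_mul x x₀
    rw [Real.dist_eq, dist_eq_norm] at this
    exact (le_abs_self _).trans this
  have hsq := mul_le_mul_of_nonneg_left (norm_sq_le_periodicBump hx) hk.le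
  rw [le_div_iff₀ (by positivity)]
  rcases (norm_nonneg (x - x₀)).eq_or_lt with h | h
  · rw [← h]
    simp
  · refine le_of_mul_le_mul_right ?_ h
    linarith

theorem mul_le_of_isCellSubsolution {N : ℕ} {H : Euc N → Euc N → ℝ} {P : Euc N} {a b : ℝ}
    {σ u : Euc N → ℝ} {K : NNReal} (hσ : Continuous σ) (hu : LipschitzWith K u)
    (hp : IsZPeriodic u) (hH : ∀ x p, σ x * b ≤ H x p) (hsub : IsCellSubsolution H P a u)
    (x₀ : Euc N) : σ x₀ * b ≤ a := by
  choose x hx hne using fun n : ℕ =>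
    exists_superDiff_nonempty_near hu hp x₀ (k := (n : ℝ) + 1) (by positivity)
  have hlim : Tendsto (fun n : ℕ => (K : ℝ) / (8 * ((n : ℝ) + 1))) atTop (nhds 0) := by
    have h := (tendsto_one_div_add_atTop_nhds_zero_nat (𝕜 := ℝ)).const_mul ((K : ℝ) / 8)
    rw [mul_zero] at h
    refine h.congr fun n => ?_
    field_simp
  have hxlim : Tendsto x atTop (nhds x₀) :=
    tendsto_iff_norm_sub_tendsto_zero.2 (squeeze_zero (fun _ => norm_nonneg _) hx hlim)
  refine le_of_tendsto (((hσ.tendsto x₀).comp hxlim).mul_const b)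
    (Eventually.of_forall fun n => ?_)
  obtain ⟨q, hq⟩ := hne n
  exact (hH _ _).trans (hsub _ q hq)

/-- Bounds on the generalized effective Hamiltonian:
`max{σ̲ m(|P|), σ̄ m₀} ≤ H̄_∞(P) ≤ σ̄ m(|P|) < σ̄`. -/
theorem generalized_effective_hamiltonian_bounds {N : ℕ} (hN : 1 ≤ N)
    (σ : Euc N → ℝ) (m : ℝ → ℝ) (L : NNReal)
    (hσc : Continuous σ) (hσp : IsZPeriodic σ) (hσpos : ∀ x, 0 < σ x)
    (hm01 : ∀ r : ℝ, 0 ≤ r → 0 < m r ∧ m r < 1)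
    (hmLip : LipschitzOnWith L m (Set.Ici 0))
    (hmmono : StrictMonoOn m (Set.Ici 0))
    (hmlim : Tendsto m atTop (nhds 1))
    (σmax σmin : ℝ)
    (hσmax : IsGreatest (Set.range σ) σmax) (hσmin : IsLeast (Set.range σ) σmin)
    (c : ℕ → Euc N → ℝ)
    (hc : ∀ (n : ℕ) (P : Euc N), ∃ u : Euc N → ℝ,
        IsCellSolution (fun x p => σ x * max (m ‖p‖) ((L : ℝ) * ‖p‖ - n)) P u (c n P))
    (Hinf : Euc N → ℝ)
    (hHinf : ∀ P : Euc N, Tendsto (fun n => c n P) atTop (nhds (Hinf P))) :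
    ∀ P : Euc N,
      max (σmin * m ‖P‖) (σmax * m 0) ≤ Hinf P ∧
      Hinf P ≤ σmax * m ‖P‖ ∧
      σmax * m ‖P‖ < σmax := by
  intro P
  obtain ⟨⟨x₁, hx₁⟩, hle⟩ := hσmax
  obtain ⟨⟨x₂, hx₂⟩, hge⟩ := hσmin
  have hmP := hm01 ‖P‖ (norm_nonneg P)
  have hσmaxpos : 0 < σmax := hx₁ ▸ hσpos x₁
  refine ⟨max_le ?_ ?_, ?_, by nlinarith⟩
  · refine ge_of_tendsto (hHinf P) (Eventually.of_forall fun n => ?_)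
    obtain ⟨u, ⟨K, hK⟩, hp, hsub, -⟩ := hc n P
    obtain ⟨x, -, hmax⟩ := hp.exists_max_mem_cube hK.continuous 0
    have h := hsub x 0 (zero_mem_superDiff hmax)
    rw [zero_add] at h
    refine le_trans ?_ h
    exact mul_le_mul (hge ⟨x, rfl⟩) (le_max_left _ _) hmP.1.le (hσpos x).le
  · refine ge_of_tendsto (hHinf P) (Eventually.of_forall fun n => ?_)
    obtain ⟨u, ⟨K, hK⟩, hp, hsub, -⟩ := hc n P
    rw [← hx₁]
    refine mul_le_of_isCellSubsolution hσc hK hp (fun x p => ?_) hsub x₁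
    refine mul_le_mul_of_nonneg_left (le_max_of_le_left ?_) (hσpos x).le
    exact hmmono.monotoneOn Set.self_mem_Ici (norm_nonneg p) (norm_nonneg p)
  · obtain ⟨n₀, hn₀⟩ := exists_nat_ge ((L : ℝ) * ‖P‖)
    refine le_of_tendsto (hHinf P) ((eventually_ge_atTop n₀).mono fun n hn => ?_)
    obtain ⟨u, ⟨K, hK⟩, hp, -, hsup⟩ := hc n P
    obtain ⟨x, -, hmax⟩ := IsZPeriodic.exists_max_mem_cube (f := fun x => -u x)
      hK.continuous.neg (fun x z => by simp only [hp x z]) 0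
    have h := hsup x 0 (zero_mem_subDiff fun y => neg_le_neg_iff.1 (hmax y))
    have hn' : (n₀ : ℝ) ≤ n := by exact_mod_cast hn
    simp only [zero_add] at h
    rw [max_eq_left (by linarith [hmP.1])] at h
    exact h.trans (mul_le_mul_of_nonneg_right (hle ⟨x, rfl⟩) hmP.1.le)
end
end
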